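/- If K is an infinite field of characteristic p > 2, then I_p ⊆ T_2(E_{0*}⊗E_0); in particular, for all n ≥ 0 and k ≥ 1 with 2n + 2k − 1 = p, the polynomials [y_1,z_1]⋯[y_{2k−2},z_1](z_2∘z_1)z_1^{2n} and [y_1,z_1]⋯[y_{2k−1},z_1]z_1^{2n} are 2-graded identities of E_{0*}⊗E_0. -/

import Mathlib

open scoped TensorProduct

noncomputable section

namespace Paper

variable (K : Type) [Field K]

/-- The Grassmann algebra `E` of a vector space with countable basis. -/
abbrev E := ExteriorAlgebra K (ℕ →₀ K)

/-- The generators `e_i` of the Grassmann algebra (0-based indexing). -/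
def eGen (i : ℕ) : E K := ExteriorAlgebra.ι K (Finsupp.single i 1)

/-- The basis monomial `e_{i_1} ⋯ e_{i_k}` of `E`, `i_1 < ⋯ < i_k`, indexed by a finite set. -/
def eMon (s : Finset ℕ) : E K := ((s.sort (· ≤ ·)).map (eGen K)).prod

/-- The algebra `A = E ⊗ E`. -/
abbrev A := E K ⊗[K] E K

/-- The canonical basis of `E ⊗ E`, indexed by pairs of finite sets (= supports). -/
def bEE (q : Finset ℕ × Finset ℕ) : A K := eMon K q.1 ⊗ₜ[K] eMon K q.2

/-- The `ℤ₂ × ℤ₂`-degree of a canonical basis element in the canonical grading of `E ⊗ E`. -/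
def gdeg (q : Finset ℕ × Finset ℕ) : ZMod 2 × ZMod 2 :=
  ((q.1.card : ZMod 2), (q.2.card : ZMod 2))

/-- The homogeneous component of degree `g` of the canonical `ℤ₂ × ℤ₂`-grading of `E ⊗ E`. -/
def Acomp (g : ZMod 2 × ZMod 2) : Submodule K (A K) :=
  Submodule.span K { a | ∃ q, gdeg q = g ∧ a = bEE K q }

/-- Degree of a basis monomial of `E ⊗ E` in the `ℤ₂`-grading induced by weight functions
`w₁, w₂` on the generators of the two factors. -/
def wdeg (w₁ w₂ : ℕ → ZMod 2) (q : Finset ℕ × Finset ℕ) : ZMod 2 :=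
  (∑ i ∈ q.1, w₁ i) + (∑ j ∈ q.2, w₂ j)

/-- Homogeneous component of degree `δ` of the `ℤ₂`-grading of `E ⊗ E` induced by weights. -/
def Agr (w₁ w₂ : ℕ → ZMod 2) (δ : ZMod 2) : Submodule K (A K) :=
  Submodule.span K { a | ∃ q, wdeg w₁ w₂ q = δ ∧ a = bEE K q }

/-- Weights for `E_∞`:  `‖e_i‖ = 1` iff `i` is even (paper's 1-based `e_i` is our `i-1`). -/
def wInf : ℕ → ZMod 2 := fun i => if i % 2 = 1 then 1 else 0

/-- Weights for `E_{k*}`:  `‖e_i‖ = 1` for `i ≤ k`, else `0`. -/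
def wKstar (k : ℕ) : ℕ → ZMod 2 := fun i => if i < k then 1 else 0

/-- Weights for `E_k`:  `‖e_i‖ = 0` for `i ≤ k`, else `1`. -/
def wK (k : ℕ) : ℕ → ZMod 2 := fun i => if i < k then 0 else 1

/-- The `ℤ₂`-grading `E_{0*} ⊗ E_0` of `A = E ⊗ E`: `A₀ = E⊗E⁰`, `A₁ = E⊗E¹`. -/
def A0star (δ : ZMod 2) : Submodule K (A K) := Agr K (wKstar 0) (wK 0) δ

/-- The free associative algebra `K⟨Y ∪ Z⟩`: variable `(false, i)` is `y_i`,
variable `(true, i)` is `z_i`. -/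
abbrev FA := FreeAlgebra K (Bool × ℕ)

/-- The even variables `y_i`. -/
def Yv (i : ℕ) : FA K := FreeAlgebra.ι K (false, i)

/-- The odd variables `z_i`. -/
def Zv (i : ℕ) : FA K := FreeAlgebra.ι K (true, i)

/-- The Jordan product `a ∘ b = ab + ba`. -/
def circ {R : Type*} [Ring R] (a b : R) : R := a * b + b * a

/-- Substitution `y_i ↦ a i`, `z_i ↦ z i` as an algebra homomorphism. -/
def ev {B : Type*} [Ring B] [Algebra K B] (a z : ℕ → B) : FA K →ₐ[K] B :=
  FreeAlgebra.lift K (fun v => if v.1 then z v.2 else a v.2)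

/-- `f` is a 2-graded polynomial identity of the `ℤ₂`-graded algebra `B = B₀ ⊕ B₁`. -/
def GIdent {B : Type*} [Ring B] [Algebra K B] (B0 B1 : Submodule K B) (f : FA K) : Prop :=
  ∀ a z : ℕ → B, (∀ i, a i ∈ B0) → (∀ i, z i ∈ B1) → ev K a z f = 0

/-- `f` is an ordinary polynomial identity of `B`. -/
def OIdent (B : Type) [Ring B] [Algebra K B] (f : FA K) : Prop :=
  ∀ u : Bool × ℕ → B, FreeAlgebra.lift K u f = 0

/-- The homogeneous component of degree `δ` of the free algebra `K⟨Y ∪ Z⟩`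
(span of the monomials whose number of odd variables has parity `δ`). -/
def FAdeg (δ : ZMod 2) : Submodule K (FA K) :=
  Submodule.span K { w | ∃ l : List (Bool × ℕ),
    ((l.countP (fun v => v.1) : ℕ) : ZMod 2) = δ ∧ w = (l.map (FreeAlgebra.ι K)).prod }

/-- A grading-preserving endomorphism of the free algebra `K⟨Y ∪ Z⟩`. -/
def GradedEndo (φ : FA K →ₐ[K] FA K) : Prop :=
  (∀ i, φ (Yv K i) ∈ FAdeg K 0) ∧ (∀ i, φ (Zv K i) ∈ FAdeg K 1)

/-- A two-sided ideal of `K⟨Y ∪ Z⟩` is a `T₂`-ideal if it is invariant under all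
grading-preserving endomorphisms. -/
def IsT2Ideal (J : TwoSidedIdeal (FA K)) : Prop :=
  ∀ φ : FA K →ₐ[K] FA K, GradedEndo K φ → ∀ x ∈ J, φ x ∈ J

/-- The `T₂`-ideal generated by a set `S`: the smallest two-sided ideal containing `S`
and invariant under all grading-preserving endomorphisms. -/
def T2IdealGen (S : Set (FA K)) : TwoSidedIdeal (FA K) :=
  sInf { J | S ⊆ J ∧ IsT2Ideal K J }

/-- The generators (1)–(7) of the `T₂`-ideal `I`. -/
def gens : Set (FA K) :=
  { ⁅⁅Yv K 1, Yv K 2⁆, Yv K 3⁆, ⁅⁅Yv K 1, Yv K 2⁆, Zv K 3⁆,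
    ⁅⁅Yv K 1, Zv K 2⁆, Yv K 3⁆,
    circ ⁅Yv K 1, Zv K 2⁆ (Zv K 3),
    ⁅circ (Zv K 1) (Zv K 2), Zv K 3⁆,
    circ (Zv K 1) (Zv K 2) * circ (Zv K 3) (Zv K 4)
      - circ (Zv K 1) (Zv K 3) * circ (Zv K 2) (Zv K 4),
    ⁅Yv K 1, Yv K 2⁆ * ⁅Yv K 3, Yv K 4⁆ + ⁅Yv K 1, Yv K 3⁆ * ⁅Yv K 2, Yv K 4⁆,
    ⁅Yv K 1, Yv K 2⁆ * ⁅Yv K 3, Zv K 4⁆ + ⁅Yv K 1, Yv K 3⁆ * ⁅Yv K 2, Zv K 4⁆,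
    ⁅Zv K 1, Yv K 2⁆ * ⁅Yv K 3, Yv K 4⁆ + ⁅Zv K 1, Yv K 3⁆ * ⁅Yv K 2, Yv K 4⁆,
    ⁅Zv K 1, Yv K 2⁆ * ⁅Yv K 3, Zv K 4⁆ + ⁅Zv K 1, Yv K 3⁆ * ⁅Yv K 2, Zv K 4⁆,
    ⁅Yv K 1, Zv K 2⁆ * circ (Zv K 3) (Zv K 4) - ⁅Yv K 1, Zv K 3⁆ * circ (Zv K 2) (Zv K 4) }

/-- The product `[y_1, z_1][y_2, z_1] ⋯ [y_k, z_1]`. -/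
def prodYZ (k : ℕ) : FA K := ((List.range k).map (fun i => ⁅Yv K (i + 1), Zv K 1⁆)).prod

/-- The generators (1)–(7) together with (8) and (9) of the `T₂`-ideal `I_p`. -/
def gensP (p : ℕ) : Set (FA K) :=
  gens K ∪ { f | ∃ n k : ℕ, 1 ≤ k ∧ 2 * n + 2 * k - 1 = p ∧
    (f = prodYZ K (2 * k - 2) * circ (Zv K 2) (Zv K 1) * (Zv K 1) ^ (2 * n) ∨
     f = prodYZ K (2 * k - 1) * (Zv K 1) ^ (2 * n)) }

/-- The polynomial `h = h_y · h_{y,z} · h_z`, given by the lists of index pairs of the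
commutators `[y,y]`, the commutators `[y,z]` and the Jordan products `z ∘ z`. -/
def hpoly (ly lyz lz : List (ℕ × ℕ)) : FA K :=
  (ly.map (fun p => ⁅Yv K p.1, Yv K p.2⁆)).prod *
  (lyz.map (fun p => ⁅Yv K p.1, Zv K p.2⁆)).prod *
  (lz.map (fun p => circ (Zv K p.1) (Zv K p.2))).prod

/-- The list `i_1, …, i_{2m+n}` of indices of the even variables occurring in `h`. -/
def yIdx (ly lyz : List (ℕ × ℕ)) : List ℕ :=
  (ly.flatMap fun p => [p.1, p.2]) ++ lyz.map Prod.fst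

/-- The list `j_1, …, j_{n+2p}` of indices of the odd variables occurring in `h`. -/
def zIdx (lyz lz : List (ℕ × ℕ)) : List ℕ :=
  lyz.map Prod.snd ++ (lz.flatMap fun p => [p.1, p.2])

/-- A left-normed higher commutator of variables `[x_{v}, x_{w}, x_{u_1}, …]` (length ≥ 2). -/
def commList (v w : Bool × ℕ) (l : List (Bool × ℕ)) : FA K :=
  l.foldl (fun acc u => ⁅acc, FreeAlgebra.ι K u⁆) ⁅FreeAlgebra.ι K v, FreeAlgebra.ι K w⁆

/-- The generators of the subalgebra `B(Y,Z)` of `Y`-proper polynomials: the odd variables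
and the nontrivial higher commutators of variables. -/
def ProperGens : Set (FA K) :=
  Set.range (Zv K) ∪ { c | ∃ v w l, c = commList K v w l }

end Paper

namespace Paper

section BasisMonomials

variable (K : Type) [Field K]

theorem eGen_mul_self (i : ℕ) : eGen K i * eGen K i = 0 :=
  ExteriorAlgebra.ι_sq_zero _

theorem eGen_mul_eGen (i j : ℕ) : eGen K i * eGen K j = -(eGen K j * eGen K i) :=
  eq_neg_of_add_eq_zero_left (ExteriorAlgebra.ι_add_mul_swap _ _)

theorem prod_map_eGen_perm {l m : List ℕ} (h : l.Perm m) :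
    (l.map (eGen K)).prod = (m.map (eGen K)).prod ∨
      (l.map (eGen K)).prod = -(m.map (eGen K)).prod := by
  induction h with
  | nil => exact Or.inl rfl
  | cons x _ ih =>
    rcases ih with ih | ih <;> simp [ih]
  | swap x y l =>
    right
    simp only [List.map_cons, List.prod_cons, ← mul_assoc]
    rw [eGen_mul_eGen K y x, neg_mul]
  | trans _ _ ih₁ ih₂ =>
    rcases ih₁ with h₁ | h₁ <;> rcases ih₂ with h₂ | h₂ <;> simp [h₁, h₂]

theorem prod_map_eGen_of_not_nodup {l : List ℕ} (h : ¬ l.Nodup) :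
    (l.map (eGen K)).prod = 0 := by
  obtain ⟨x, hx⟩ := List.exists_duplicate_iff_not_nodup.mpr h
  obtain ⟨m, hm⟩ := (List.duplicate_iff_sublist.mp hx).exists_perm_append
  have h0 : (([x, x] ++ m).map (eGen K)).prod = 0 := by
    simp [← mul_assoc, eGen_mul_self]
  rcases prod_map_eGen_perm K hm with h | h <;> rw [h, h0]
  exact neg_zero

theorem prod_map_eGen_eq (l : List ℕ) :
    (l.map (eGen K)).prod = 0 ∨ ∃ u : Finset ℕ, u.card = l.length ∧
      ((l.map (eGen K)).prod = eMon K u ∨ (l.map (eGen K)).prod = -eMon K u) := by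
  by_cases h : l.Nodup
  · right
    refine ⟨l.toFinset, List.toFinset_card_of_nodup h, prod_map_eGen_perm K ?_⟩
    refine (List.perm_ext_iff_of_nodup h (Finset.sort_nodup _ _)).mpr fun a => ?_
    simp
  · exact Or.inl (prod_map_eGen_of_not_nodup K h)

theorem eMon_mul_eMon (s t : Finset ℕ) :
    eMon K s * eMon K t = 0 ∨ ∃ u : Finset ℕ, u.card = s.card + t.card ∧
      (eMon K s * eMon K t = eMon K u ∨ eMon K s * eMon K t = -eMon K u) := by
  simpa [eMon] using prod_map_eGen_eq K (s.sort (· ≤ ·) ++ t.sort (· ≤ ·))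

theorem eMon_mul_self {s : Finset ℕ} (hs : s.Nonempty) : eMon K s * eMon K s = 0 := by
  obtain ⟨x, hx⟩ := hs
  have h := prod_map_eGen_of_not_nodup K (l := s.sort (· ≤ ·) ++ s.sort (· ≤ ·)) fun h =>
    (List.nodup_append.mp h).2.2 x (by simpa using hx) x (by simpa using hx) rfl
  simpa [eMon] using h

theorem eGen_mul_prod (i : ℕ) (l : List ℕ) :
    eGen K i * (l.map (eGen K)).prod = (-1 : K) ^ l.length • ((l.map (eGen K)).prod * eGen K i) := by
  induction l with
  | nil => simp
  | cons j l ih =>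
    simp only [List.map_cons, List.prod_cons, List.length_cons]
    rw [← mul_assoc, eGen_mul_eGen, neg_mul, mul_assoc, ih, pow_succ, mul_smul_comm, mul_assoc]
    simp

theorem prod_mul_prod (l m : List ℕ) :
    (l.map (eGen K)).prod * (m.map (eGen K)).prod =
      (-1 : K) ^ (l.length * m.length) • ((m.map (eGen K)).prod * (l.map (eGen K)).prod) := by
  induction l with
  | nil => simp
  | cons i l ih =>
    simp only [List.map_cons, List.prod_cons, List.length_cons]
    rw [mul_assoc, ih, mul_smul_comm, ← mul_assoc, eGen_mul_prod, smul_mul_assoc, smul_smul,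
      ← pow_add, mul_assoc, add_mul, one_mul]

theorem eMon_mul_comm (s t : Finset ℕ) :
    eMon K s * eMon K t = (-1 : K) ^ (s.card * t.card) • (eMon K t * eMon K s) := by
  simpa [eMon] using prod_mul_prod K (s.sort (· ≤ ·)) (t.sort (· ≤ ·))

theorem bEE_mul_comm (q r : Finset ℕ × Finset ℕ) :
    bEE K q * bEE K r =
      (-1 : K) ^ (q.1.card * r.1.card + q.2.card * r.2.card) • (bEE K r * bEE K q) := by
  simp only [bEE, Algebra.TensorProduct.tmul_mul_tmul]
  rw [eMon_mul_comm K q.1, eMon_mul_comm K q.2, TensorProduct.smul_tmul_smul, pow_add]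

theorem bEE_mul_mem (q r : Finset ℕ × Finset ℕ) :
    bEE K q * bEE K r ∈ Acomp K (gdeg q + gdeg r) := by
  simp only [bEE, Algebra.TensorProduct.tmul_mul_tmul]
  rcases eMon_mul_eMon K q.1 r.1 with h₁ | ⟨u, hu, h₁⟩
  · simp [h₁]
  rcases eMon_mul_eMon K q.2 r.2 with h₂ | ⟨v, hv, h₂⟩
  · simp [h₂]
  have hb : eMon K u ⊗ₜ[K] eMon K v ∈ Acomp K (gdeg q + gdeg r) :=
    Submodule.subset_span ⟨(u, v), by simp [gdeg, hu, hv], rfl⟩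
  rcases h₁ with h₁ | h₁ <;> rcases h₂ with h₂ | h₂ <;>
    simpa [h₁, h₂, TensorProduct.neg_tmul, TensorProduct.tmul_neg] using hb

end BasisMonomials

section Components

variable {K : Type} [Field K]

theorem mul_mem_Acomp {g h : ZMod 2 × ZMod 2} {x y : A K} (hx : x ∈ Acomp K g)
    (hy : y ∈ Acomp K h) : x * y ∈ Acomp K (g + h) := by
  induction hx, hy using Submodule.span_induction₂ with
  | mem_mem x y hx hy =>
    obtain ⟨q, rfl, rfl⟩ := hx
    obtain ⟨r, rfl, rfl⟩ := hy
    exact bEE_mul_mem K q r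
  | zero_left y _ => simp
  | zero_right x _ => simp
  | add_left x y z _ _ _ h₁ h₂ => rw [add_mul]; exact add_mem h₁ h₂
  | add_right x y z _ _ _ h₁ h₂ => rw [mul_add]; exact add_mem h₁ h₂
  | smul_left c x y _ _ h => rw [smul_mul_assoc]; exact Submodule.smul_mem _ _ h
  | smul_right c x y _ _ h => rw [mul_smul_comm]; exact Submodule.smul_mem _ _ h

theorem mul_mem_Acomp_mk {i j δ ε : ZMod 2} {x y : A K} (hx : x ∈ Acomp K (i, δ))
    (hy : y ∈ Acomp K (j, ε)) : x * y ∈ Acomp K (i + j, δ + ε) := by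
  rw [← Prod.mk_add_mk]
  exact mul_mem_Acomp hx hy

theorem mul_eq_smul_mul_of_bEE {g h : ZMod 2 × ZMod 2} (c : K)
    (H : ∀ q r, gdeg q = g → gdeg r = h → bEE K q * bEE K r = c • (bEE K r * bEE K q))
    {x y : A K} (hx : x ∈ Acomp K g) (hy : y ∈ Acomp K h) : x * y = c • (y * x) := by
  induction hx, hy using Submodule.span_induction₂ with
  | mem_mem x y hx hy =>
    obtain ⟨q, hq, rfl⟩ := hx
    obtain ⟨r, hr, rfl⟩ := hy
    exact H q r hq hr
  | zero_left y _ => simp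
  | zero_right x _ => simp
  | add_left x y z _ _ _ h₁ h₂ => rw [add_mul, mul_add, h₁, h₂, smul_add]
  | add_right x y z _ _ _ h₁ h₂ => rw [add_mul, mul_add, h₁, h₂, smul_add]
  | smul_left d x y _ _ h => rw [smul_mul_assoc, mul_smul_comm, h, smul_comm]
  | smul_right d x y _ _ h => rw [smul_mul_assoc, mul_smul_comm, h, smul_comm]

theorem mul_comm_of_Acomp {g h : ZMod 2 × ZMod 2} (hgh : g.1 * h.1 + g.2 * h.2 = 0)
    {x y : A K} (hx : x ∈ Acomp K g) (hy : y ∈ Acomp K h) : x * y = y * x := by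
  rw [← one_smul K (y * x)]
  refine mul_eq_smul_mul_of_bEE 1 (fun q r hq hr => ?_) hx hy
  subst hq hr
  have he : Even (q.1.card * r.1.card + q.2.card * r.2.card) := by
    rw [← ZMod.natCast_eq_zero_iff_even]
    simpa [gdeg] using hgh
  rw [bEE_mul_comm, he.neg_one_pow]

theorem mul_anticomm_of_Acomp {g h : ZMod 2 × ZMod 2} (hgh : g.1 * h.1 + g.2 * h.2 = 1)
    {x y : A K} (hx : x ∈ Acomp K g) (hy : y ∈ Acomp K h) : x * y = -(y * x) := by
  rw [← neg_one_smul K (y * x)]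
  refine mul_eq_smul_mul_of_bEE (-1) (fun q r hq hr => ?_) hx hy
  subst hq hr
  have ho : Odd (q.1.card * r.1.card + q.2.card * r.2.card) := by
    rw [← ZMod.natCast_eq_one_iff_odd]
    simpa [gdeg] using hgh
  rw [bEE_mul_comm, ho.neg_one_pow]

theorem wdeg_zero_star (q : Finset ℕ × Finset ℕ) :
    wdeg (wKstar 0) (wK 0) q = (q.2.card : ZMod 2) := by
  simp [wdeg, wKstar, wK]

theorem exists_components {δ : ZMod 2} {x : A K} (hx : x ∈ A0star K δ) :
    ∃ x₀ ∈ Acomp K (0, δ), ∃ x₁ ∈ Acomp K (1, δ), x = x₀ + x₁ := by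
  induction hx using Submodule.span_induction with
  | mem x hx =>
    obtain ⟨q, hq, rfl⟩ := hx
    rw [wdeg_zero_star] at hq
    have h2 : ∀ c : ZMod 2, c = 0 ∨ c = 1 := by decide
    rcases h2 (q.1.card : ZMod 2) with h | h
    · exact ⟨_, Submodule.subset_span ⟨q, by simp [gdeg, h, hq], rfl⟩, 0, zero_mem _, by simp⟩
    · exact ⟨0, zero_mem _, _, Submodule.subset_span ⟨q, by simp [gdeg, h, hq], rfl⟩, by simp⟩
  | zero => exact ⟨0, zero_mem _, 0, zero_mem _, by simp⟩
  | add x y _ _ hx hy =>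
    obtain ⟨x₀, hx₀, x₁, hx₁, rfl⟩ := hx
    obtain ⟨y₀, hy₀, y₁, hy₁, rfl⟩ := hy
    exact ⟨_, add_mem hx₀ hy₀, _, add_mem hx₁ hy₁, by abel⟩
  | smul c x _ hx =>
    obtain ⟨x₀, hx₀, x₁, hx₁, rfl⟩ := hx
    exact ⟨_, Submodule.smul_mem _ c hx₀, _, Submodule.smul_mem _ c hx₁, smul_add _ _ _⟩

theorem Acomp_le_A0star (i δ : ZMod 2) : Acomp K (i, δ) ≤ A0star K δ := by
  refine Submodule.span_mono ?_
  rintro _ ⟨q, hq, rfl⟩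
  exact ⟨q, by rw [wdeg_zero_star]; exact congrArg Prod.snd hq, rfl⟩

theorem mul_mem_A0star {δ ε : ZMod 2} {x y : A K} (hx : x ∈ A0star K δ)
    (hy : y ∈ A0star K ε) : x * y ∈ A0star K (δ + ε) := by
  obtain ⟨x₀, hx₀, x₁, hx₁, rfl⟩ := exists_components hx
  obtain ⟨y₀, hy₀, y₁, hy₁, rfl⟩ := exists_components hy
  rw [add_mul, mul_add, mul_add]
  exact add_mem
    (add_mem (Acomp_le_A0star _ _ (mul_mem_Acomp_mk hx₀ hy₀))
      (Acomp_le_A0star _ _ (mul_mem_Acomp_mk hx₀ hy₁)))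
    (add_mem (Acomp_le_A0star _ _ (mul_mem_Acomp_mk hx₁ hy₀))
      (Acomp_le_A0star _ _ (mul_mem_Acomp_mk hx₁ hy₁)))

theorem one_mem_A0star : (1 : A K) ∈ A0star K 0 :=
  Submodule.subset_span ⟨(∅, ∅), by simp [wdeg], by simp [bEE, eMon, Algebra.TensorProduct.one_def]⟩

theorem pow_char_eq_zero {p : ℕ} [CharP K p] (hp : 2 < p) {t : A K}
    (ht : t ∈ Acomp K (1, 1)) : t ^ p = 0 := by
  have hprime : p.Prime :=
    (CharP.char_is_prime_or_zero K p).resolve_right (by omega)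
  have : Fact p.Prime := ⟨hprime⟩
  rcases subsingleton_or_nontrivial (A K) with hs | hn
  · exact Subsingleton.elim _ _
  have : CharP (A K) p := charP_of_injective_algebraMap (algebraMap K (A K)).injective p
  induction ht using Submodule.span_induction with
  | mem x hx =>
    obtain ⟨q, hq, rfl⟩ := hx
    have hne : q.1.Nonempty := by
      rw [Finset.nonempty_iff_ne_empty]
      intro h
      simp [gdeg, h] at hq
    have hsq : bEE K q ^ 2 = 0 := by
      rw [pow_two, bEE, Algebra.TensorProduct.tmul_mul_tmul, eMon_mul_self K hne,
        TensorProduct.zero_tmul]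
    exact pow_eq_zero_of_le hp.le hsq
  | zero => exact zero_pow hprime.ne_zero
  | add x y hx hy hx' hy' =>
    rw [add_pow_char_of_commute p (mul_comm_of_Acomp (by decide) hx hy), hx', hy', add_zero]
  | smul c x _ hx => rw [smul_pow, hx, smul_zero]

theorem lie_even_right {δ : ZMod 2} {x₀ x₁ y₀ y₁ : A K} (hx₀ : x₀ ∈ Acomp K (0, δ))
    (hx₁ : x₁ ∈ Acomp K (1, δ)) (hy₀ : y₀ ∈ Acomp K (0, 0)) (hy₁ : y₁ ∈ Acomp K (1, 0)) :
    ⁅x₀ + x₁, y₀ + y₁⁆ = 2 * (x₁ * y₁) := by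
  rw [Ring.lie_def, add_mul, mul_add, mul_add, add_mul, mul_add, mul_add,
    mul_comm_of_Acomp (by simp) hy₀ hx₀, mul_comm_of_Acomp (by simp) hy₀ hx₁,
    mul_comm_of_Acomp (by simp) hy₁ hx₀, mul_anticomm_of_Acomp (by simp) hy₁ hx₁, two_mul]
  abel

theorem lie_even_left {δ : ZMod 2} {x₀ x₁ y₀ y₁ : A K} (hx₀ : x₀ ∈ Acomp K (0, δ))
    (hx₁ : x₁ ∈ Acomp K (1, δ)) (hy₀ : y₀ ∈ Acomp K (0, 0)) (hy₁ : y₁ ∈ Acomp K (1, 0)) :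
    ⁅y₀ + y₁, x₀ + x₁⁆ = 2 * (y₁ * x₁) := by
  have h := lie_even_right hx₀ hx₁ hy₀ hy₁
  rw [Ring.lie_def] at h ⊢
  rw [← neg_sub, h, mul_anticomm_of_Acomp (by simp) hx₁ hy₁, mul_neg, neg_neg]

theorem circ_odd {x₀ x₁ y₀ y₁ : A K} (hx₀ : x₀ ∈ Acomp K (0, 1))
    (hx₁ : x₁ ∈ Acomp K (1, 1)) (hy₀ : y₀ ∈ Acomp K (0, 1)) (hy₁ : y₁ ∈ Acomp K (1, 1)) :
    circ (x₀ + x₁) (y₀ + y₁) = 2 * (x₁ * y₁) := by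
  rw [circ, add_mul, mul_add, mul_add, add_mul, mul_add, mul_add,
    mul_anticomm_of_Acomp (by simp) hy₀ hx₀, mul_anticomm_of_Acomp (by simp) hy₀ hx₁,
    mul_anticomm_of_Acomp (by simp) hy₁ hx₀, mul_comm_of_Acomp (by decide) hy₁ hx₁, two_mul]
  abel

theorem commute_central {δ : ZMod 2} {c x : A K} (hc : c ∈ Acomp K (0, 0))
    (hx : x ∈ A0star K δ) : c * x = x * c := by
  obtain ⟨x₀, hx₀, x₁, hx₁, rfl⟩ := exists_components hx
  rw [mul_add, add_mul, mul_comm_of_Acomp (by simp) hc hx₀, mul_comm_of_Acomp (by simp) hc hx₁]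

theorem lie_two_mul_eq_zero {c x : A K} (h : c * x = x * c) : ⁅2 * c, x⁆ = 0 := by
  rw [Ring.lie_def, mul_assoc, h, two_mul, two_mul, mul_add, sub_self]

theorem circ_two_mul_eq_zero {c x : A K} (h : c * x = -(x * c)) : circ (2 * c) x = 0 := by
  rw [circ, mul_assoc, h, two_mul, two_mul, mul_add]
  abel

theorem sq_odd {p : ℕ} [CharP K p] (hp : 2 < p) {x₀ x₁ : A K} (hx₀ : x₀ ∈ Acomp K (0, 1))
    (hx₁ : x₁ ∈ Acomp K (1, 1)) : (x₀ + x₁) ^ 2 = x₁ ^ 2 := by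
  have h := circ_odd hx₀ hx₁ hx₀ hx₁
  have h2 : (2 : K) ≠ 0 := by
    intro h
    have := (CharP.cast_eq_zero_iff K p 2).mp (by exact_mod_cast h)
    exact absurd (Nat.le_of_dvd two_pos this) (by omega)
  have h' : (2 : K) • (x₀ + x₁) ^ 2 = (2 : K) • x₁ ^ 2 := by
    rw [two_smul, two_smul, pow_two, pow_two, ← two_mul (x₁ * x₁), ← h, circ]
  exact smul_right_injective (A K) h2 h'

theorem exists_pow_mul_eq {t v : A K} (ht : t ∈ Acomp K (1, 1)) (hv : v ∈ Acomp K (1, 0))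
    (m : ℕ) : ∃ w, t ^ m * v = w * t ^ m := by
  have h : SemiconjBy v t (-t) := by
    rw [SemiconjBy, mul_anticomm_of_Acomp (by simp) hv ht, neg_mul]
  refine ⟨(-1) ^ m * v, ?_⟩
  rw [mul_assoc, (h.pow_right m).eq, ← mul_assoc, ← (Commute.neg_one_left (-t)).mul_pow,
    neg_one_mul, neg_neg]

end Components

section Evaluation

variable {K : Type} [Field K] (a z : ℕ → A K)

theorem ev_Yv (i : ℕ) : ev K a z (Yv K i) = a i := by simp [ev, Yv]

theorem ev_Zv (i : ℕ) : ev K a z (Zv K i) = z i := by simp [ev, Zv]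

theorem ev_lie (x y : FA K) : ev K a z ⁅x, y⁆ = ⁅ev K a z x, ev K a z y⁆ := by
  simp [Ring.lie_def]

theorem ev_circ (x y : FA K) : ev K a z (circ x y) = circ (ev K a z x) (ev K a z y) := by
  simp [circ]

variable {a z}

theorem ev_mem_A0star (ha : ∀ i, a i ∈ A0star K 0) (hz : ∀ i, z i ∈ A0star K 1) {δ : ZMod 2}
    {f : FA K} (hf : f ∈ FAdeg K δ) : ev K a z f ∈ A0star K δ := by
  induction hf using Submodule.span_induction with
  | mem f hf =>
    obtain ⟨l, rfl, rfl⟩ := hf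
    induction l with
    | nil => simpa using one_mem_A0star
    | cons v l ih =>
      obtain ⟨b, i⟩ := v
      rw [List.map_cons, List.prod_cons, map_mul, List.countP_cons, Nat.cast_add, add_comm]
      refine mul_mem_A0star ?_ ih
      cases b
      · simpa [ev] using ha i
      · simpa [ev] using hz i
  | zero => simp
  | add x y _ _ hx hy => rw [map_add]; exact add_mem hx hy
  | smul c x _ hx => rw [map_smul]; exact Submodule.smul_mem _ _ hx

theorem exists_ev_prodYZ (ha : ∀ i, a i ∈ A0star K 0) {s t : A K} (hs : s ∈ Acomp K (0, 1))
    (ht : t ∈ Acomp K (1, 1)) (hst : z 1 = s + t) (m : ℕ) :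
    ∃ w, ev K a z (prodYZ K m) = w * t ^ m := by
  induction m with
  | zero => exact ⟨1, by simp [prodYZ]⟩
  | succ m ih =>
    obtain ⟨w, hw⟩ := ih
    obtain ⟨u, hu, v, hv, huv⟩ := exists_components (ha (m + 1))
    obtain ⟨w', hw'⟩ := exists_pow_mul_eq ht hv m
    refine ⟨2 * (w * w'), ?_⟩
    have hprod : prodYZ K (m + 1) = prodYZ K m * ⁅Yv K (m + 1), Zv K 1⁆ := by
      simp [prodYZ, List.range_succ]
    rw [hprod, map_mul, hw, ev_lie, ev_Yv, ev_Zv, huv, hst, lie_even_left hs ht hu hv]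
    have h2 : w * t ^ m * 2 = 2 * (w * t ^ m) := by rw [mul_two, two_mul]
    rw [← mul_assoc, h2, mul_assoc, mul_assoc, ← mul_assoc (t ^ m), hw', pow_succ]
    simp only [mul_assoc]

theorem gIdent_prodYZ_mul_pow {p : ℕ} [CharP K p] (hp : 2 < p) {n k : ℕ} (hk : 1 ≤ k)
    (hnk : 2 * n + 2 * k - 1 = p) :
    GIdent K (A0star K 0) (A0star K 1) (prodYZ K (2 * k - 1) * (Zv K 1) ^ (2 * n)) := by
  intro a z ha hz
  obtain ⟨s, hs, t, ht, hst⟩ := exists_components (hz 1)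
  obtain ⟨w, hw⟩ := exists_ev_prodYZ ha hs ht hst (2 * k - 1)
  rw [map_mul, hw, map_pow, ev_Zv, hst, pow_mul, sq_odd hp hs ht, ← pow_mul, mul_assoc, ← pow_add,
    show 2 * k - 1 + 2 * n = p by omega, pow_char_eq_zero hp ht, mul_zero]

theorem gIdent_prodYZ_mul_circ_mul_pow {p : ℕ} [CharP K p] (hp : 2 < p) {n k : ℕ} (hk : 1 ≤ k)
    (hnk : 2 * n + 2 * k - 1 = p) :
    GIdent K (A0star K 0) (A0star K 1)
      (prodYZ K (2 * k - 2) * circ (Zv K 2) (Zv K 1) * (Zv K 1) ^ (2 * n)) := by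
  intro a z ha hz
  obtain ⟨s, hs, t, ht, hst⟩ := exists_components (hz 1)
  obtain ⟨s', hs', t', ht', hst'⟩ := exists_components (hz 2)
  obtain ⟨w, hw⟩ := exists_ev_prodYZ ha hs ht hst (2 * k - 2)
  have hc : circ (z 2) (z 1) = t * (t' + t') := by
    rw [hst, hst', circ_odd hs' ht' hs ht, mul_comm_of_Acomp (by decide) ht' ht, two_mul, mul_add]
  have hcomm : Commute (t' + t') (t ^ (2 * n)) :=
    (show Commute (t' + t') t from
      mul_comm_of_Acomp (by decide) (add_mem ht' ht') ht).pow_right _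
  rw [map_mul, map_mul, ev_circ, hw, map_pow, ev_Zv, ev_Zv, hc, hst, pow_mul, sq_odd hp hs ht,
    ← pow_mul, mul_assoc, mul_assoc t, hcomm.eq, ← mul_assoc t, ← pow_succ', mul_assoc,
    ← mul_assoc (t ^ _), ← pow_add, show 2 * k - 2 + (2 * n + 1) = p by omega,
    pow_char_eq_zero hp ht, zero_mul, mul_zero]

theorem two_mul_mul_two_mul (x y : A K) : 2 * x * (2 * y) = 4 * (x * y) := by
  noncomm_ring

theorem gIdent_of_mem_gens {f : FA K} (hf : f ∈ gens K) :
    GIdent K (A0star K 0) (A0star K 1) f := by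
  intro a z ha hz
  choose u hu v hv huv using fun i => exists_components (ha i)
  choose s hs t ht hst using fun i => exists_components (hz i)
  have hyy (i j : ℕ) : ⁅a i, a j⁆ = 2 * (v i * v j) := by
    rw [huv i, huv j, lie_even_left (hu j) (hv j) (hu i) (hv i)]
  have hyz (i j : ℕ) : ⁅a i, z j⁆ = 2 * (v i * t j) := by
    rw [huv i, hst j, lie_even_left (hs j) (ht j) (hu i) (hv i)]
  have hzy (i j : ℕ) : ⁅z i, a j⁆ = 2 * (t i * v j) := by
    rw [hst i, huv j, lie_even_right (hs i) (ht i) (hu j) (hv j)]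
  have hzz (i j : ℕ) : circ (z i) (z j) = 2 * (t i * t j) := by
    rw [hst i, hst j, circ_odd (hs i) (ht i) (hs j) (ht j)]
  have hvv (i j : ℕ) : v i * v j ∈ Acomp K (0, 0) := by
    simpa [one_add_one_eq_two, show (2 : ZMod 2) = 0 from rfl] using
      mul_mem_Acomp_mk (hv i) (hv j)
  have hvt (i j : ℕ) : v i * t j ∈ Acomp K (0, 1) := by
    simpa [one_add_one_eq_two, show (2 : ZMod 2) = 0 from rfl] using
      mul_mem_Acomp_mk (hv i) (ht j)
  have htt (i j : ℕ) : t i * t j ∈ Acomp K (0, 0) := by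
    simpa [one_add_one_eq_two, show (2 : ZMod 2) = 0 from rfl] using
      mul_mem_Acomp_mk (ht i) (ht j)
  have swap_v (x y : A K) (i j : ℕ) : x * v i * (v j * y) + x * v j * (v i * y) = 0 := by
    have h := mul_anticomm_of_Acomp (by simp) (hv i) (hv j)
    rw [mul_assoc, ← mul_assoc (v i), h, mul_assoc x, ← mul_assoc (v j), neg_mul, mul_neg,
      neg_add_cancel]
  have swap_t (x y : A K) (i j : ℕ) : x * t i * (t j * y) - x * t j * (t i * y) = 0 := by
    have h := mul_comm_of_Acomp (by decide) (ht i) (ht j)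
    rw [mul_assoc, ← mul_assoc (t i), h, mul_assoc x, ← mul_assoc (t j), sub_self]
  rcases hf with rfl | rfl | rfl | rfl | rfl | rfl | rfl | rfl | rfl | rfl | rfl <;>
    simp only [map_add, map_sub, map_mul, ev_lie, ev_circ, ev_Yv, ev_Zv, hyy, hyz, hzy, hzz,
      two_mul_mul_two_mul, ← mul_add, ← mul_sub, swap_v, swap_t, mul_zero]
  · exact lie_two_mul_eq_zero (commute_central (hvv 1 2) (ha 3))
  · exact lie_two_mul_eq_zero (commute_central (hvv 1 2) (hz 3))
  · refine lie_two_mul_eq_zero ?_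
    rw [huv 3, mul_add, add_mul, mul_comm_of_Acomp (by simp) (hvt 1 2) (hu 3),
      mul_comm_of_Acomp (by simp) (hvt 1 2) (hv 3)]
  · refine circ_two_mul_eq_zero ?_
    rw [hst 3, mul_add, add_mul, mul_anticomm_of_Acomp (by simp) (hvt 1 2) (hs 3),
      mul_anticomm_of_Acomp (by simp) (hvt 1 2) (ht 3), neg_add]
  · exact lie_two_mul_eq_zero (commute_central (htt 1 2) (hz 3))

variable (K)

/-- The two-sided ideal of the `2`-graded identities of `E_{0*} ⊗ E_0`. -/
def gradedIdentities : TwoSidedIdeal (FA K) :=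
  TwoSidedIdeal.mk' {f | GIdent K (A0star K 0) (A0star K 1) f}
    (fun _ _ _ _ => map_zero _)
    (fun hx hy a z ha hz => by rw [map_add, hx a z ha hz, hy a z ha hz, add_zero])
    (fun hx a z ha hz => by rw [map_neg, hx a z ha hz, neg_zero])
    (fun hy a z ha hz => by rw [map_mul, hy a z ha hz, mul_zero])
    (fun hx a z ha hz => by rw [map_mul, hx a z ha hz, zero_mul])

theorem mem_gradedIdentities {f : FA K} :
    f ∈ gradedIdentities K ↔ GIdent K (A0star K 0) (A0star K 1) f :=
  TwoSidedIdeal.mem_mk' _ _ _ _ _ _ _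

theorem isT2Ideal_gradedIdentities : IsT2Ideal K (gradedIdentities K) := by
  intro φ hφ f hf
  rw [mem_gradedIdentities] at hf ⊢
  intro a z ha hz
  have hcomp : (ev K a z).comp φ =
      ev K (fun i => ev K a z (φ (Yv K i))) (fun i => ev K a z (φ (Zv K i))) := by
    ext ⟨b, i⟩
    cases b <;> simp [ev, Yv, Zv]
  have h := hf _ _ (fun i => ev_mem_A0star ha hz (hφ.1 i)) (fun i => ev_mem_A0star ha hz (hφ.2 i))
  rwa [← hcomp] at h

theorem gIdent_of_mem_T2IdealGen {S : Set (FA K)}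
    (hS : ∀ f ∈ S, GIdent K (A0star K 0) (A0star K 1) f) {f : FA K} (hf : f ∈ T2IdealGen K S) :
    GIdent K (A0star K 0) (A0star K 1) f := by
  have hle : T2IdealGen K S ≤ gradedIdentities K :=
    sInf_le ⟨fun g hg => (mem_gradedIdentities K).mpr (hS g hg), isT2Ideal_gradedIdentities K⟩
  exact (mem_gradedIdentities K).mp (hle hf)

end Evaluation

/-- over an infinite field of characteristic `p > 2` the `T₂`-ideal `I_p`
is contained in `T₂(E_{0*} ⊗ E_0)`; in particular the polynomials (8) and (9) are
2-graded identities of `E_{0*} ⊗ E_0`. -/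
theorem Ip_subset_T2 (K : Type) [Field K] [Infinite K] (p : ℕ) (hp : 2 < p) [CharP K p] :
    (∀ f ∈ T2IdealGen K (gensP K p), GIdent K (A0star K 0) (A0star K 1) f) ∧
    (∀ n k : ℕ, 1 ≤ k → 2 * n + 2 * k - 1 = p →
      GIdent K (A0star K 0) (A0star K 1)
        (prodYZ K (2 * k - 2) * circ (Zv K 2) (Zv K 1) * (Zv K 1) ^ (2 * n)) ∧
      GIdent K (A0star K 0) (A0star K 1)
        (prodYZ K (2 * k - 1) * (Zv K 1) ^ (2 * n))) := by
  refine ⟨fun f hf => gIdent_of_mem_T2IdealGen K ?_ hf, fun n k hk hnk =>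
    ⟨gIdent_prodYZ_mul_circ_mul_pow hp hk hnk, gIdent_prodYZ_mul_pow hp hk hnk⟩⟩
  rintro g (hg | ⟨n, k, hk, hnk, rfl | rfl⟩)
  · exact gIdent_of_mem_gens hg
  · exact gIdent_prodYZ_mul_circ_mul_pow hp hk hnk
  · exact gIdent_prodYZ_mul_pow hp hk hnk

end Paper
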